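/- Let p be an odd prime, let G be a quasi-powerful p-group and let i be a nonnegative integer. Then the subgroup G^{p^i} generated by the p^i-th powers coincides with the set {g^{p^i} : g ∈ G} of p^i-th powers; that is, every element of G^{p^i} is itself a p^i-th power of some element of G. -/

import Mathlib

/-- The subgroup of `G` generated by all `n`-th powers. -/
def powSubgroup (G : Type*) [Group G] (n : ℕ) : Subgroup G :=
  Subgroup.closure {x : G | ∃ g : G, g ^ n = x}

/-- `Ω_k`-type subgroup: generated by all elements whose `n`-th power is trivial. -/
def omegaSubgroup (G : Type*) [Group G] (n : ℕ) : Subgroup G :=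
  Subgroup.closure {g : G | g ^ n = 1}

/-- A group is powerful (for a prime `p`) if `[G,G] ≤ G^p`. -/
def IsPowerful (p : ℕ) (G : Type*) [Group G] : Prop :=
  commutator G ≤ powSubgroup G p

/-- A group is quasi-powerful (for a prime `p`) if `G/Z(G)` is powerful. -/
def IsQuasiPowerful (p : ℕ) (G : Type*) [Group G] : Prop :=
  IsPowerful p (G ⧸ Subgroup.center G)

/-- The commutator `[x,y] = x⁻¹y⁻¹xy`. -/
def pcomm {G : Type*} [Group G] (a b : G) : G := a⁻¹ * b⁻¹ * a * b

section QuasiPowerful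

open Subgroup
open scoped commutatorElement

/-- The subgroup generated by the `n`-th powers of the elements of the subgroup `H`. -/
def powersOf {G : Type*} [Group G] (H : Subgroup G) (n : ℕ) : Subgroup G :=
  closure {x : G | ∃ g ∈ H, g ^ n = x}

/-- The subgroup generated by all commutators and all `p`-th powers. -/
def commutatorPow (p : ℕ) (G : Type*) [Group G] : Subgroup G :=
  commutator G ⊔ powSubgroup G p

section PowerFormula

variable {G : Type*} [Group G]

theorem mul_pow_eq_of_commute {a b d : G} (hab : b * a = d * a * b) (hda : Commute d a)
    (hdb : Commute d b) (n : ℕ) : (a * b) ^ n = d ^ (n.choose 2) * a ^ n * b ^ n := by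
  have key : ∀ n : ℕ, b ^ n * a = d ^ n * a * b ^ n := by
    intro n
    induction n with
    | zero => simp
    | succ n ih =>
      calc b ^ (n + 1) * a = b ^ n * (b * a) := by rw [pow_succ, mul_assoc]
        _ = (b ^ n * d) * a * b := by rw [hab]; group
        _ = d * (b ^ n * a) * b := by rw [(hdb.pow_right n).eq.symm]; group
        _ = d ^ (n + 1) * a * b ^ (n + 1) := by
          rw [ih, pow_succ', pow_succ]; simp only [mul_assoc]
  induction n with
  | zero => simp
  | succ n ih =>
    have h2 : (n + 1).choose 2 = n.choose 2 + n := by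
      rw [Nat.choose_succ_succ' n 1, Nat.choose_one_right, add_comm]
    calc (a * b) ^ (n + 1) = d ^ (n.choose 2) * a ^ n * (b ^ n * a) * b := by
          rw [pow_succ, ih]; simp only [mul_assoc]
      _ = d ^ (n.choose 2) * (a ^ n * d ^ n) * a * b ^ n * b := by
          rw [key]; simp only [mul_assoc]
      _ = d ^ ((n + 1).choose 2) * a ^ (n + 1) * b ^ (n + 1) := by
          rw [(hda.pow_pow n n).eq.symm, h2, pow_add, pow_succ a, pow_succ b]
          simp only [mul_assoc]

theorem mul_pow_prime_of_commute {p : ℕ} (hp : p.Prime) (hodd : Odd p) {a b : G}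
    (hda : Commute ⁅b, a⁆ a) (hdb : Commute ⁅b, a⁆ b) (hd : ⁅b, a⁆ ^ p = 1) :
    (a * b) ^ p = a ^ p * b ^ p := by
  have hlt : 2 < p := lt_of_le_of_ne hp.two_le (by rintro rfl; exact absurd hodd (by decide))
  obtain ⟨k, hk⟩ := hp.dvd_choose_self two_ne_zero hlt
  rw [mul_pow_eq_of_commute (d := ⁅b, a⁆) (by rw [commutatorElement_def]; group) hda hdb, hk,
    pow_mul, hd, one_pow, one_mul]

end PowerFormula

section Basic

variable {G : Type*} [Group G]

theorem pow_mem_powersOf {H : Subgroup G} {g : G} (hg : g ∈ H) (n : ℕ) : g ^ n ∈ powersOf H n :=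
  subset_closure ⟨g, hg, rfl⟩

theorem powersOf_le {H K : Subgroup G} {n : ℕ} : powersOf H n ≤ K ↔ ∀ g ∈ H, g ^ n ∈ K := by
  refine (closure_le K).trans ⟨fun h g hg => h ⟨g, hg, rfl⟩, ?_⟩
  rintro h _ ⟨g, hg, rfl⟩
  exact h g hg

theorem powersOf_mono {H K : Subgroup G} (h : H ≤ K) (n : ℕ) : powersOf H n ≤ powersOf K n :=
  powersOf_le.2 fun _ hg => pow_mem_powersOf (h hg) n

theorem powSubgroup_eq_powersOf_top (n : ℕ) : powSubgroup G n = powersOf ⊤ n := by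
  simp [powSubgroup, powersOf]

theorem pow_mem_powSubgroup (g : G) (n : ℕ) : g ^ n ∈ powSubgroup G n :=
  subset_closure ⟨g, rfl⟩

theorem powSubgroup_le {K : Subgroup G} {n : ℕ} : powSubgroup G n ≤ K ↔ ∀ g : G, g ^ n ∈ K := by
  rw [powSubgroup_eq_powersOf_top, powersOf_le]
  simp

theorem powersOf_eq_map (H : Subgroup G) (n : ℕ) :
    powersOf H n = (powSubgroup H n).map H.subtype := by
  apply le_antisymm
  · exact powersOf_le.2 fun g hg => ⟨⟨g, hg⟩ ^ n, pow_mem_powSubgroup _ n, rfl⟩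
  · rw [map_le_iff_le_comap]
    exact powSubgroup_le.2 fun g => pow_mem_powersOf g.2 n

instance powersOf_normal (H : Subgroup G) [hH : H.Normal] (n : ℕ) : (powersOf H n).Normal := by
  refine ⟨fun x hx g => ?_⟩
  have h : powersOf H n ≤ (powersOf H n).comap (MulAut.conj g).toMonoidHom :=
    powersOf_le.2 fun y hy => by
      have := pow_mem_powersOf (hH.conj_mem y hy g) n
      rw [conj_pow] at this
      exact this
  exact h hx

instance powSubgroup_normal (n : ℕ) : (powSubgroup G n).Normal := by
  rw [powSubgroup_eq_powersOf_top]; infer_instance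

instance commutatorPow_normal (p : ℕ) : (commutatorPow p G).Normal := by
  unfold commutatorPow; infer_instance

theorem commute_mk_iff {N : Subgroup G} [N.Normal] {a b : G} :
    Commute (a : G ⧸ N) (b : G ⧸ N) ↔ ⁅a, b⁆ ∈ N := by
  rw [← commutatorElement_eq_one_iff_commute, ← QuotientGroup.eq_one_iff]
  rfl

theorem isQuasiPowerful_iff {p : ℕ} :
    IsQuasiPowerful p G ↔ commutator G ≤ powSubgroup G p ⊔ center G := by
  let f := QuotientGroup.mk' (center G)
  have hf : Function.Surjective f := QuotientGroup.mk'_surjective _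
  have h1 : commutator (G ⧸ center G) = (commutator G).map f := by
    rw [_root_.commutator_def, _root_.commutator_def, map_commutator, map_top_of_surjective f hf]
  have h2 : powSubgroup (G ⧸ center G) p = (powSubgroup G p).map f := by
    apply le_antisymm
    · rw [powSubgroup_le]
      intro q
      obtain ⟨g, rfl⟩ := hf q
      exact ⟨g ^ p, pow_mem_powSubgroup g p, map_pow f g p⟩
    · rw [map_le_iff_le_comap, powSubgroup_le]
      intro g
      rw [mem_comap, map_pow]
      exact pow_mem_powSubgroup _ p
  rw [IsQuasiPowerful, IsPowerful, h1, h2, Subgroup.map_le_map_iff, QuotientGroup.ker_mk']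

theorem isQuasiPowerful_of_commutator_le {p : ℕ} {H : Subgroup G}
    (h : ⁅H, H⁆ ≤ powersOf H p ⊔ (H ⊓ center G)) : IsQuasiPowerful p H := by
  rw [isQuasiPowerful_iff, ← map_le_map_iff_of_injective H.subtype_injective,
    map_subtype_commutator, Subgroup.map_sup, ← powersOf_eq_map]
  refine h.trans (sup_le_sup_left ?_ _)
  rintro x ⟨hx, hxc⟩
  refine ⟨⟨x, hx⟩, mem_center_iff.2 fun g => Subtype.ext ?_, rfl⟩
  exact mem_center_iff.1 hxc g

theorem le_of_le_sup_commutator [Group.IsNilpotent G] {K N : Subgroup G} [N.Normal]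
    (h : K ≤ N ⊔ ⁅K, ⊤⁆) : K ≤ N := by
  have key : ∀ n, K ≤ N ⊔ (⊤ : Subgroup G).lowerCentralSeries n := by
    intro n
    induction n with
    | zero => simp
    | succ n ih =>
      refine h.trans (sup_le le_sup_left (commutator_le.2 fun a ha b _ => ?_))
      obtain ⟨u, hu, v, hv, rfl⟩ := mem_sup_of_normal_left.1 (ih ha)
      rw [commutatorElement_mul_left_eq_conj_mul]
      refine mul_mem (Normal.conj_mem inferInstance _ (mem_sup_right ?_) u) (mem_sup_left ?_)
      · exact commutator_mem_commutator hv (mem_top b)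
      · exact commutator_le_left N ⊤ (commutator_mem_commutator hu (mem_top b))
  obtain ⟨n, hn⟩ := _root_.Subgroup.nilpotent_iff_lowerCentralSeries.1 ‹_›
  simpa [hn] using key n

end Basic

section QuasiPowerfulGroup

variable {G : Type*} [Group G] {p : ℕ}

theorem commutatorElement_mem_commutatorPow (a b : G) : ⁅a, b⁆ ∈ commutatorPow p G :=
  mem_sup_left (commutator_mem_commutator (mem_top a) (mem_top b))

theorem commutator_commutatorPow_le [Group.IsNilpotent G] (hp : p.Prime) (hodd : Odd p)
    (hQP : IsQuasiPowerful p G) :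
    ⁅commutatorPow p G, (⊤ : Subgroup G)⁆ ≤ powersOf (commutatorPow p G) p := by
  apply le_of_le_sup_commutator
  set K := ⁅commutatorPow p G, (⊤ : Subgroup G)⁆ with hK
  set M := powersOf (commutatorPow p G) p ⊔ ⁅K, ⊤⁆
  have hpow : powSubgroup G p ≤ (center (G ⧸ M)).comap (QuotientGroup.mk' M) := by
    refine powSubgroup_le.2 fun x => mem_center_iff.2 fun q => ?_
    obtain ⟨y, rfl⟩ := QuotientGroup.mk'_surjective M q
    simp only [QuotientGroup.mk'_apply, QuotientGroup.mk_pow]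
    have hd : ⁅x, ⁅y, x⁆⁆ ∈ K := by
      rw [hK, commutator_comm]
      exact commutator_mem_commutator (mem_top x) (commutatorElement_mem_commutatorPow y x)
    have hcomm (z : G) : Commute ((⁅x, ⁅y, x⁆⁆ : G) : G ⧸ M) z :=
      commute_mk_iff.2 (mem_sup_right (commutator_mem_commutator hd (mem_top z)))
    have hpw {z : G} (hz : z ∈ commutatorPow p G) : (z : G ⧸ M) ^ p = 1 := by
      rw [← QuotientGroup.mk_pow, QuotientGroup.eq_one_iff]
      exact mem_sup_left (pow_mem_powersOf hz p)
    have key := mul_pow_prime_of_commute hp hodd (a := ((⁅y, x⁆ : G) : G ⧸ M)) (b := (x : G ⧸ M))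
      (hcomm _) (hcomm _) (hpw (commutator_le_left _ _ hd))
    rw [hpw (commutatorElement_mem_commutatorPow y x), one_mul] at key
    have hconj : ((⁅y, x⁆ : G) : G ⧸ M) * x = y * x * (y : G ⧸ M)⁻¹ := by
      rw [commutatorElement_def]; simp
    rw [hconj, conj_pow, mul_inv_eq_iff_eq_mul] at key
    exact key
  have hcenter : center G ≤ (center (G ⧸ M)).comap (QuotientGroup.mk' M) := by
    refine fun z hz => mem_center_iff.2 fun q => ?_
    obtain ⟨y, rfl⟩ := QuotientGroup.mk'_surjective M q
    rw [← map_mul, mem_center_iff.1 hz y, map_mul]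
  have hle : commutatorPow p G ≤ (center (G ⧸ M)).comap (QuotientGroup.mk' M) :=
    sup_le ((isQuasiPowerful_iff.1 hQP).trans (sup_le hpow hcenter)) hpow
  refine commutator_le.2 fun a ha b _ => commute_mk_iff.1 ?_
  exact (mem_center_iff.1 (hle ha) b).symm

theorem exists_pow_mul_eq_of_mem_powSubgroup [Group.IsNilpotent G] (hp : p.Prime) (hodd : Odd p)
    (hQP : IsQuasiPowerful p G) {g : G} (hg : g ∈ powSubgroup G p) :
    ∃ x : G, ∃ y ∈ powersOf (commutatorPow p G) p, x ^ p * y = g := by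
  set N := powersOf (commutatorPow p G) p
  have hcomm (a b z : G) : Commute ((⁅a, b⁆ : G) : G ⧸ N) z :=
    commute_mk_iff.2 (commutator_commutatorPow_le hp hodd hQP
      (commutator_mem_commutator (commutatorElement_mem_commutatorPow a b) (mem_top z)))
  have hmul (a b : G) : ((a : G ⧸ N) * b) ^ p = (a : G ⧸ N) ^ p * (b : G ⧸ N) ^ p := by
    refine mul_pow_prime_of_commute hp hodd (hcomm b a a) (hcomm b a b) ?_
    exact (QuotientGroup.eq_one_iff (⁅b, a⁆ ^ p)).2
      (pow_mem_powersOf (commutatorElement_mem_commutatorPow b a) p)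
  suffices ∃ x : G, (x : G ⧸ N) ^ p = g by
    obtain ⟨x, hx⟩ := this
    exact ⟨x, (x ^ p)⁻¹ * g, QuotientGroup.eq.1 hx, mul_inv_cancel_left _ _⟩
  induction hg using closure_induction with
  | mem x hx =>
    obtain ⟨y, rfl⟩ := hx
    exact ⟨y, rfl⟩
  | one => exact ⟨1, by simp⟩
  | mul a b _ _ iha ihb =>
    obtain ⟨x, hx⟩ := iha
    obtain ⟨y, hy⟩ := ihb
    exact ⟨x * y, by rw [QuotientGroup.mk_mul, hmul, hx, hy, QuotientGroup.mk_mul]⟩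
  | inv a _ iha =>
    obtain ⟨x, hx⟩ := iha
    exact ⟨x⁻¹, by rw [QuotientGroup.mk_inv, inv_pow, hx, QuotientGroup.mk_inv]⟩

theorem IsPGroup.commutatorPow_le_frattini [Finite G] (hp : p.Prime) (hG : IsPGroup p G) :
    commutatorPow p G ≤ frattini G := by
  have := Fact.mk hp
  have := hG.isNilpotent
  refine le_iInf₂ fun M hM => ?_
  have : M.Normal := NormalizerCondition.normal_of_coatom M Group.normalizerCondition_of_isNilpotent hM
  have hQ : IsPGroup p (G ⧸ M) := hG.to_quotient M
  have hnt : Nontrivial (G ⧸ M) := QuotientGroup.nontrivial_iff.2 hM.1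
  have hsimple (L : Subgroup (G ⧸ M)) : L = ⊥ ∨ L = ⊤ := by
    have hsurj := QuotientGroup.mk'_surjective M
    have hle : M ≤ L.comap (QuotientGroup.mk' M) := QuotientGroup.le_comap_mk' M L
    rcases hM.le_iff.1 hle with h | h
    · right
      rw [← map_comap_eq_self_of_surjective hsurj L, h, map_top_of_surjective _ hsurj]
    · left
      rw [← map_comap_eq_self_of_surjective hsurj L, h, QuotientGroup.map_mk'_self]
  have hcenter : center (G ⧸ M) = ⊤ := (hsimple _).resolve_left hQ.bot_lt_center.ne'
  have hcomm : IsMulCommutative (G ⧸ M) := center_eq_top_iff.1 hcenter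
  have : IsSimpleGroup (G ⧸ M) := ⟨fun L _ => hsimple L⟩
  have hprime : (Nat.card (G ⧸ M)).Prime := Group.is_simple_iff_prime_card.1 this
  have hcard : Nat.card (G ⧸ M) = p := by
    have := hQ.card_eq_or_dvd.resolve_left hprime.one_lt.ne'
    exact ((Nat.prime_dvd_prime_iff_eq hp hprime).1 this).symm
  refine sup_le (Normal.quotient_commutative_iff_commutator_le.1 hcomm) (powSubgroup_le.2 ?_)
  intro g
  rw [← QuotientGroup.eq_one_iff, QuotientGroup.mk_pow, ← hcard, pow_card_eq_one']

theorem commutator_zpowers_sup_le (x : G) {N L : Subgroup G} [N.Normal] [L.Normal]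
    (h : ⁅N, ⊤⁆ ≤ L) : ⁅zpowers x ⊔ N, zpowers x ⊔ N⁆ ≤ L := by
  have hcomm {a : G} (ha : a ∈ N) (b : G) : Commute (a : G ⧸ L) b :=
    commute_mk_iff.2 (h (commutator_mem_commutator ha (mem_top b)))
  refine commutator_le.2 fun a ha b hb => commute_mk_iff.1 ?_
  obtain ⟨_, ⟨k, rfl⟩, u, hu, rfl⟩ := mem_sup_of_normal_right.1 ha
  obtain ⟨_, ⟨m, rfl⟩, v, hv, rfl⟩ := mem_sup_of_normal_right.1 hb
  simp only [QuotientGroup.mk_mul]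
  refine Commute.mul_left (Commute.mul_right ?_ (hcomm hv _).symm)
    (hcomm hu _)
  simp only [QuotientGroup.mk_zpow]
  exact ((Commute.refl (x : G ⧸ L)).zpow_zpow k m)

theorem exists_pow_eq_of_mem_powSubgroup (hp : p.Prime) (hodd : Odd p) [Finite G]
    (hG : IsPGroup p G) (hQP : IsQuasiPowerful p G) {g : G} (hg : g ∈ powSubgroup G p) :
    ∃ x : G, x ^ p = g := by
  have := Fact.mk hp
  induction hn : Nat.card G using Nat.strong_induction_on generalizing G with
  | _ n ih =>
  subst hn
  have := hG.isNilpotent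
  obtain ⟨x, y, hy, hxy⟩ := exists_pow_mul_eq_of_mem_powSubgroup hp hodd hQP hg
  set H := zpowers x ⊔ commutatorPow p G
  have hxH : x ∈ H := mem_sup_left (mem_zpowers x)
  have hle : powersOf (commutatorPow p G) p ≤ powersOf H p := powersOf_mono le_sup_right p
  by_cases htop : H = ⊤
  · have hz : zpowers x = ⊤ := frattini_nongenerating <| top_le_iff.1 <|
      htop.ge.trans (sup_le_sup_left (hG.commutatorPow_le_frattini hp) _)
    have hc (a b : G) : Commute a b := by
      obtain ⟨k, rfl⟩ := mem_zpowers_iff.1 (hz.ge (mem_top a))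
      obtain ⟨m, rfl⟩ := mem_zpowers_iff.1 (hz.ge (mem_top b))
      exact (Commute.refl x).zpow_zpow k m
    clear hxy
    induction hg using closure_induction with
    | mem x hx => exact hx
    | one => exact ⟨1, one_pow p⟩
    | mul a b _ _ iha ihb =>
      obtain ⟨u, rfl⟩ := iha
      obtain ⟨v, rfl⟩ := ihb
      exact ⟨u * v, (hc u v).mul_pow p⟩
    | inv a _ iha =>
      obtain ⟨u, rfl⟩ := iha
      exact ⟨u⁻¹, inv_pow u p⟩
  · have hgH : x ^ p * y ∈ powersOf H p := mul_mem (pow_mem_powersOf hxH p) (hle hy)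
    rw [hxy, powersOf_eq_map] at hgH
    obtain ⟨z, hz, hzg⟩ := hgH
    have hQH : IsQuasiPowerful p H := isQuasiPowerful_of_commutator_le <|
      (commutator_zpowers_sup_le x (commutator_commutatorPow_le hp hodd hQP)).trans
        (hle.trans le_sup_left)
    have hlt : Nat.card H < Nat.card G :=
      lt_of_le_of_ne H.card_le_card_group fun h => htop (eq_top_of_card_eq H h)
    obtain ⟨w, rfl⟩ := ih _ hlt (hG.to_subgroup H) hQH hz rfl
    exact ⟨w, by rw [← hzg]; rfl⟩

theorem isQuasiPowerful_powSubgroup [Group.IsNilpotent G] (hp : p.Prime) (hodd : Odd p)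
    (hQP : IsQuasiPowerful p G) : IsQuasiPowerful p (powSubgroup G p) := by
  apply isQuasiPowerful_of_commutator_le
  have hle : commutatorPow p G ≤ powSubgroup G p ⊔ center G :=
    sup_le (isQuasiPowerful_iff.1 hQP) le_sup_left
  refine (commutator_mono le_sup_right le_top).trans
    ((commutator_commutatorPow_le hp hodd hQP).trans (powersOf_le.2 fun f hf => ?_))
  obtain ⟨h, hh, z, hz, rfl⟩ := mem_sup_of_normal_left.1 (hle hf)
  rw [Commute.mul_pow (mem_center_iff.1 hz h)]
  exact mul_mem_sup (pow_mem_powersOf hh p) ⟨pow_mem_powSubgroup z p, pow_mem hz p⟩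

end QuasiPowerfulGroup

end QuasiPowerful

theorem powSubgroup_eq_set_of_powers (p : ℕ) (hp : p.Prime) (hodd : Odd p)
    (G : Type*) [Group G] [Finite G]
    (hG : IsPGroup p G) (hQP : IsQuasiPowerful p G) (i : ℕ) :
    ∀ x ∈ powSubgroup G (p ^ i), ∃ g : G, g ^ p ^ i = x := by
  have := Fact.mk hp
  induction i generalizing G with
  | zero => exact fun x _ => ⟨x, by simp⟩
  | succ i ih =>
    intro x hx
    have := hG.isNilpotent
    have hle : powSubgroup G (p ^ (i + 1)) ≤ powersOf (powSubgroup G p) (p ^ i) := by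
      refine powSubgroup_le.2 fun g => ?_
      rw [pow_succ', pow_mul]
      exact pow_mem_powersOf (pow_mem_powSubgroup g p) _
    have hx' := hle hx
    rw [powersOf_eq_map] at hx'
    obtain ⟨y, hy, rfl⟩ := hx'
    obtain ⟨z, rfl⟩ := ih _ (hG.to_subgroup _) (isQuasiPowerful_powSubgroup hp hodd hQP) y hy
    obtain ⟨w, hw⟩ := exists_pow_eq_of_mem_powSubgroup hp hodd hG hQP z.2
    exact ⟨w, by rw [pow_succ', pow_mul, hw]; rfl⟩
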